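/- arXiv:2008.03199 — 2 statements merged into one kernel-verified Lean document; each statement's English description precedes it below -/
import Mathlib

section
/- Let k be a field of prime characteristic p, G a finite group, and N a normal subgroup of G whose order is divisible by p. Let I = kG·I(kN) be the kernel of the canonical algebra surjection kG → k[G/N]. Then the right annihilator of I in kG is contained in I. -/
universe u

/-- Let `k` be a field of prime characteristic `p`, `G` a finite group and `N`
a normal subgroup of `G` of order divisible by `p`.  Let `I` be the kernel of the canonical
algebra surjection `kG → k[G/N]`.  Then the right annihilator of `I` in `kG` is contained
in `I`. -/
theorem stmt8 (k : Type u) [Field k] (p : ℕ) [Fact p.Prime] [CharP k p]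
    (G : Type u) [Group G] [Finite G] (N : Subgroup G) [N.Normal]
    (hdvd : p ∣ Nat.card N) :
    {a : MonoidAlgebra k G |
        ∀ x ∈ RingHom.ker (MonoidAlgebra.mapDomainRingHom k (QuotientGroup.mk' N)), x * a = 0}
      ⊆ (RingHom.ker (MonoidAlgebra.mapDomainRingHom k (QuotientGroup.mk' N)) :
          Set (MonoidAlgebra k G)) := by
  classical
  intro a ha
  have := Fintype.ofFinite G
  have := Fintype.ofFinite N
  -- left multiplication by elements of N fixes the coefficients of `a`
  have hinv : ∀ n ∈ N, ∀ g : G, a.coeff (n * g) = a.coeff g := by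
    intro n hn g
    have h1 : MonoidAlgebra.single n⁻¹ (1 : k) - MonoidAlgebra.single 1 1 ∈
        RingHom.ker (MonoidAlgebra.mapDomainRingHom k (QuotientGroup.mk' N)) := by
      have hq : ((n : G) : G ⧸ N) = 1 := (QuotientGroup.eq_one_iff n).2 hn
      rw [RingHom.mem_ker, map_sub]
      simp [hq]
    have h2 := ha _ h1
    rw [sub_mul, sub_eq_zero] at h2
    have h3 := congrArg (fun x => x.coeff g) h2
    simpa [MonoidAlgebra.coeff_single_mul_apply] using h3
  have hcard : (Nat.card N : k) = 0 := (CharP.cast_eq_zero_iff k p _).2 hdvd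
  change a ∈ RingHom.ker _
  rw [RingHom.mem_ker]
  ext q
  obtain ⟨g₀, rfl⟩ := QuotientGroup.mk_surjective q
  have hsum : ((MonoidAlgebra.mapDomainRingHom k (QuotientGroup.mk' N)) a).coeff (g₀ : G ⧸ N)
      = ∑ g : G, if (g : G ⧸ N) = (g₀ : G ⧸ N) then a.coeff g else 0 := by
    change (Finsupp.mapDomain (QuotientGroup.mk' N) a.coeff) (g₀ : G ⧸ N) = _
    rw [Finsupp.mapDomain, Finsupp.sum_apply, Finsupp.sum_fintype _ _ (by simp)]
    simp [Finsupp.single_apply]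
  rw [hsum, ← Finset.sum_filter]
  have hb : ∑ g ∈ Finset.univ.filter (fun g : G => (g : G ⧸ N) = (g₀ : G ⧸ N)), a.coeff g
      = ∑ n : N, a.coeff ((n : G) * g₀) := by
    symm
    refine Finset.sum_bij (fun (n : N) _ => (n : G) * g₀) ?_ ?_ ?_ ?_
    · intro n _
      have hq : ((n : G) : G ⧸ N) = 1 := (QuotientGroup.eq_one_iff _).2 n.2
      simp [hq]
    · intro m _ n _ h
      exact Subtype.ext (mul_right_cancel h)
    · intro g hg
      have hg' : (g : G ⧸ N) = (g₀ : G ⧸ N) := by simpa using hg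
      refine ⟨⟨g * g₀⁻¹, ?_⟩, Finset.mem_univ _, by simp⟩
      rw [← QuotientGroup.eq_one_iff]
      simp [hg']
    · intro n _
      rfl
  rw [hb, Finset.sum_congr rfl (fun (n : N) _ => hinv (n : G) n.2 g₀)]
  rw [Finset.sum_const, Finset.card_univ, ← Nat.card_eq_fintype_card, nsmul_eq_mul, hcard,
    zero_mul]
  simp
end

section
/- Let A be a finite-dimensional selfinjective algebra over a field k, and let I be a nonzero proper ideal of A contained in the Jacobson radical J(A) such that the quotient algebra A/I is selfinjective. Then Ext¹_A(A/I, A/I) ≠ 0. -/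
universe u

open CategoryTheory


/-- `r(l(K)) = K` for finitely generated right ideals of a left selfinjective ring. -/
lemma double_ann {R : Type u} [Ring R] (hR : Module.Injective R R) [IsNoetherian Rᵐᵒᵖ R]
    (K : Submodule Rᵐᵒᵖ R) (b : R) (hb : ∀ a : R, (∀ x ∈ K, a * x = 0) → a * b = 0) : b ∈ K := by
  obtain ⟨n, x, hx⟩ := Submodule.fg_iff_exists_fin_generating_family.mp
    (IsNoetherian.noetherian K)
  let F : R →ₗ[R] (Fin n → R) := LinearMap.pi fun i => LinearMap.toSpanSingleton R R (x i)
  have hF : ∀ a i, F a i = a * x i := fun a i => rfl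
  let g : (R ⧸ LinearMap.ker F) →ₗ[R] R :=
    (LinearMap.ker F).liftQ (LinearMap.toSpanSingleton R R b) (by
      intro a ha
      have h0 : ∀ i, a * x i = 0 := fun i => by
        rw [← hF, LinearMap.mem_ker.mp ha]; rfl
      refine hb a ?_
      intro y hy
      rw [← hx] at hy
      induction hy using Submodule.span_induction with
      | mem y hy => obtain ⟨i, rfl⟩ := hy; exact h0 i
      | zero => simp
      | add y z _ _ h1 h2 => rw [mul_add, h1, h2, add_zero]
      | smul c y _ h => rw [MulOpposite.smul_eq_mul_unop, ← mul_assoc, h, zero_mul])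
  let f : (R ⧸ LinearMap.ker F) →ₗ[R] (Fin n → R) := (LinearMap.ker F).liftQ F le_rfl
  have hf : Function.Injective f := by
    rw [← LinearMap.ker_eq_bot]; exact Submodule.ker_liftQ_eq_bot' _ _ rfl
  obtain ⟨h, hh⟩ := hR.out f hf g
  have h1 := hh (Submodule.Quotient.mk 1)
  have h2 : g (Submodule.Quotient.mk 1) = b := by
    change (1 : R) • b = b
    simp
  have h3 : f (Submodule.Quotient.mk 1) = x := by
    change F 1 = x
    ext i; simp [hF]
  rw [h2, h3, LinearMap.pi_apply_eq_sum_univ h x] at h1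
  rw [← h1]
  refine Submodule.sum_mem _ fun i _ => ?_
  have : x i ∈ K := by rw [← hx]; exact Submodule.subset_span ⟨i, rfl⟩
  exact K.smul_mem (MulOpposite.op _) this

/-- Every nonzero element of an Artinian ring has a nonzero left multiple killed by the radical. -/
lemma exists_soc {R : Type u} [Ring R] [IsArtinianRing R] (z : R) (hz : z ≠ 0) :
    ∃ a : R, a * z ≠ 0 ∧ ∀ j ∈ Ring.jacobson R, j * (a * z) = 0 := by
  obtain ⟨n, hn⟩ := IsSemiprimaryRing.isNilpotent (R := R)
  have key : ∀ n : ℕ, ∀ z : R, z ≠ 0 → (∀ j ∈ (Ring.jacobson R) ^ n, j * z = 0) →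
      ∃ a : R, a * z ≠ 0 ∧ ∀ j ∈ Ring.jacobson R, j * (a * z) = 0 := by
    intro n
    induction n with
    | zero =>
      intro z hz h
      exact absurd (by simpa using h 1 (by
        rw [Submodule.pow_zero, Submodule.one_eq_span]; exact Submodule.subset_span rfl)) hz
    | succ n ih =>
      intro z hz h
      by_cases hc : ∀ j ∈ Ring.jacobson R, j * z = 0
      · exact ⟨1, by simpa using hz, by simpa using hc⟩
      · push Not at hc
        obtain ⟨j, hj, hjz⟩ := hc
        obtain ⟨a, h1, h2⟩ := ih (j * z) hjz (by
          intro i hi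
          rw [← mul_assoc]
          exact h _ (by rw [Submodule.pow_succ]; exact Ideal.mul_mem_mul hi hj))
        exact ⟨a * j, by rwa [mul_assoc], by simpa only [mul_assoc] using h2⟩
  refine key n z hz ?_
  rw [hn]
  rintro j hj
  have : j = 0 := by simpa using hj
  simp [this]

/-- `Y(K)`: the elements killed on the left by the radical and on the right by `K`. -/
def YY {R : Type u} [Ring R] (K : Ideal R) : Submodule Rᵐᵒᵖ R where
  carrier := {s | (∀ j ∈ Ring.jacobson R, j * s = 0) ∧ ∀ c ∈ K, s * c = 0}
  add_mem' := by
    rintro a b ⟨h1, h2⟩ ⟨h3, h4⟩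
    exact ⟨fun j hj => by rw [mul_add, h1 j hj, h3 j hj, add_zero],
      fun j hj => by rw [add_mul, h2 j hj, h4 j hj, add_zero]⟩
  zero_mem' := by simp
  smul_mem' := by
    rintro c s ⟨h1, h2⟩
    refine ⟨fun j hj => ?_, fun d hd => ?_⟩
    · rw [MulOpposite.smul_eq_mul_unop, ← mul_assoc, h1 j hj, zero_mul]
    · rw [MulOpposite.smul_eq_mul_unop, mul_assoc]
      exact h2 _ (K.mul_mem_left _ hd)

/-- The left annihilator of `Y(K)`. -/
def FF {R : Type u} [Ring R] (K : Ideal R) : Ideal R where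
  carrier := {a | ∀ s ∈ YY K, a * s = 0}
  add_mem' := by
    intro a b h1 h2 s hs
    rw [add_mul, h1 s hs, h2 s hs, add_zero]
  zero_mem' := by simp
  smul_mem' := by
    intro c a h s hs
    rw [smul_eq_mul, mul_assoc, h s hs, mul_zero]

lemma FF_twoSided {R : Type u} [Ring R] (K : Ideal R) : (FF K).IsTwoSided := by
  refine ⟨fun {a} b ha s hs => ?_⟩
  rw [mul_assoc]
  refine ha _ ⟨fun j hj => ?_, fun c hc => ?_⟩
  · rw [← mul_assoc]
    exact hs.1 _ (Ideal.mul_mem_right _ _ hj)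
  · rw [mul_assoc, hs.2 c hc, mul_zero]

lemma jac_le_FF {R : Type u} [Ring R] (K : Ideal R) : Ring.jacobson R ≤ FF K :=
  fun _ hj _ hs => hs.1 _ hj

/-- `r(Y(K)) = K` for two-sided `K` containing the radical. -/
lemma ann_YY {R : Type u} [Ring R] [IsArtinianRing R] (hR : Module.Injective R R)
    [IsNoetherian Rᵐᵒᵖ R] (K : Ideal R) [K.IsTwoSided] (hK : Ring.jacobson R ≤ K) (b : R)
    (hb : ∀ s ∈ YY K, s * b = 0) : b ∈ K := by
  have : IsSemisimpleRing (R ⧸ K) :=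
    RingHom.isSemisimpleRing_of_surjective (Ideal.Quotient.factor hK)
      (Ideal.Quotient.factor_surjective hK)
  -- the ideal of right annihilators of `Y(K)`
  let N : Ideal R :=
    { carrier := {b | ∀ s ∈ YY K, s * b = 0}
      add_mem' := by
        intro a b h1 h2 s hs
        rw [mul_add, h1 s hs, h2 s hs, add_zero]
      zero_mem' := by simp
      smul_mem' := by
        intro c a h s hs
        rw [smul_eq_mul, ← mul_assoc]
        exact h _ ((YY K).smul_mem (MulOpposite.op c) hs) }
  obtain ⟨e', he', hspan⟩ := IsSemisimpleRing.ideal_eq_span_idempotent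
    (N.map (Ideal.Quotient.mk K))
  have hem : e' ∈ N.map (Ideal.Quotient.mk K) := by
    rw [hspan]; exact Ideal.subset_span rfl
  obtain ⟨e, heN, rfl⟩ := (Ideal.mem_map_iff_of_surjective _ Ideal.Quotient.mk_surjective).mp hem
  have hee : e * e - e ∈ K := by
    rw [← Ideal.Quotient.eq, map_mul]; exact he'
  let K' : Submodule Rᵐᵒᵖ R :=
    { carrier := K
      add_mem' := K.add_mem
      zero_mem' := K.zero_mem
      smul_mem' := fun c x hx => Ideal.mul_mem_right c.unop K hx }
  have heK : e ∈ K := by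
    refine double_ann hR K' e ?_
    intro x hx
    have hx : ∀ c ∈ K, x * c = 0 := hx
    by_contra hxe
    obtain ⟨a, h1, h2⟩ := exists_soc _ hxe
    have hY : a * (x * e) ∈ YY K := by
      refine ⟨h2, fun c hc => ?_⟩
      rw [mul_assoc, mul_assoc, hx _ (K.mul_mem_left _ hc), mul_zero]
    have h3 := heN _ hY
    apply h1
    have h4 : x * (e * e) = x * e := by
      rw [← sub_eq_zero, ← mul_sub]; exact hx _ hee
    rw [← h4, ← h3]; simp only [mul_assoc]
  have h0 : Ideal.Quotient.mk K e = 0 := Ideal.Quotient.eq_zero_iff_mem.mpr heK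
  have hbm : Ideal.Quotient.mk K b ∈ N.map (Ideal.Quotient.mk K) := Ideal.mem_map_of_mem _ hb
  rw [hspan, h0] at hbm
  exact Ideal.Quotient.eq_zero_iff_mem.mp (by simpa using hbm)

lemma FF_strict {R : Type u} [Ring R] [IsArtinianRing R] (hR : Module.Injective R R)
    [IsNoetherian Rᵐᵒᵖ R] (K L : Ideal R) [L.IsTwoSided] [K.IsTwoSided]
    (hK : Ring.jacobson R ≤ K) (h : K < L) : FF K < FF L := by
  have hY : YY L ≤ YY K := fun s hs => ⟨hs.1, fun c hc => hs.2 c (h.le hc)⟩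
  refine lt_of_le_not_ge (fun a ha s hs => ha s (hY hs)) fun hle => h.not_ge ?_
  intro b hb
  refine ann_YY hR K hK b fun s hs => ?_
  have : s ∈ YY L := double_ann hR _ _ fun a ha => hle ha s hs
  exact this.2 b hb

lemma FF_jac {R : Type u} [Ring R] [IsArtinianRing R] (hR : Module.Injective R R)
    [IsNoetherian Rᵐᵒᵖ R] : FF (Ring.jacobson R) = Ring.jacobson R := by
  by_contra hne
  have hlt : Ring.jacobson R < FF (Ring.jacobson R) := lt_of_le_of_ne (jac_le_FF _) (Ne.symm hne)
  let X : Set (Ideal R) := {K | K.IsTwoSided ∧ Ring.jacobson R ≤ K ∧ K < FF K}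
  obtain ⟨M, hM, hmax⟩ := (wellFounded_gt (α := Ideal R)).has_min X
    ⟨Ring.jacobson R, inferInstance, le_rfl, hlt⟩
  obtain ⟨h1, h2, h3⟩ := hM
  have := FF_twoSided M
  exact hmax (FF M) ⟨FF_twoSided M, jac_le_FF M, FF_strict hR _ _ h2 h3⟩ h3

/-- A left selfinjective Artinian algebra is left Kasch. -/
lemma kasch {R : Type u} [Ring R] [IsArtinianRing R] (hR : Module.Injective R R)
    [IsNoetherian Rᵐᵒᵖ R] (m : Ideal R) (hm : m ≠ ⊤) (hJm : Ring.jacobson R ≤ m) :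
    ∃ y : R, y ≠ 0 ∧ ∀ a ∈ m, a * y = 0 := by
  obtain ⟨u', hu', hspan⟩ := IsSemisimpleRing.ideal_eq_span_idempotent
    (m.map (Ideal.Quotient.mk (Ring.jacobson R)))
  obtain ⟨u, rfl⟩ := Ideal.Quotient.mk_surjective u'
  have hum : u ∈ m := by
    have : Ideal.Quotient.mk (Ring.jacobson R) u ∈ m.map (Ideal.Quotient.mk (Ring.jacobson R)) := by
      rw [hspan]; exact Ideal.subset_span rfl
    obtain ⟨v, hv, hvu⟩ :=
      (Ideal.mem_map_iff_of_surjective _ Ideal.Quotient.mk_surjective).mp this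
    have := hJm (Ideal.Quotient.eq.mp hvu)
    simpa using m.sub_mem hv this
  have he : (1 - u) ∉ FF (Ring.jacobson R) := by
    rw [FF_jac hR]
    intro h
    apply hm
    rw [Ideal.eq_top_iff_one]
    simpa using m.add_mem (hJm h) hum
  have : ∃ s ∈ YY (Ring.jacobson R), (1 - u) * s ≠ 0 := by
    by_contra hc
    push Not at hc
    exact he hc
  obtain ⟨s, hs, hne⟩ := this
  refine ⟨_, hne, fun a ha => ?_⟩
  rw [← mul_assoc]
  refine hs.1 _ ?_
  have ha' : Ideal.Quotient.mk (Ring.jacobson R) a ∈ m.map (Ideal.Quotient.mk (Ring.jacobson R)) :=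
    Ideal.mem_map_of_mem _ ha
  rw [hspan] at ha'
  obtain ⟨c, hc⟩ := Ideal.mem_span_singleton'.mp ha'
  rw [← Ideal.Quotient.eq_zero_iff_mem, map_mul, map_sub, map_one, ← hc, mul_assoc, mul_sub,
    mul_one, hu'.eq, sub_self, mul_zero]

/-- The nonzero homomorphism `I → A/I`. -/
lemma exists_hom {A : Type u} [Ring A] [IsNoetherianRing A] (I : Ideal A)
    (hInezero : I ≠ ⊥)
    (hIrad : I ≤ (⊥ : Ideal A).jacobson)
    {B : Type u} [Ring B] [IsArtinianRing B] [IsNoetherian Bᵐᵒᵖ B]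
    (π : A →+* B) (hπ : Function.Surjective π)
    (hker : RingHom.ker π = I) (hB : Module.Injective B B) :
    ∃ f : I →ₗ[A] (A ⧸ I), f ≠ 0 := by
  have : Nontrivial I := Submodule.nontrivial_iff_ne_bot.mpr hInezero
  obtain ⟨N, hN⟩ := IsCoatomic.exists_coatom (Submodule A I)
  have hsimple : IsSimpleModule A (I ⧸ N) := isSimpleModule_iff_isCoatom.mpr hN
  obtain ⟨x, -, hx⟩ := SetLike.exists_of_lt hN.lt_top
  let T : A →ₗ[A] (I ⧸ N) := LinearMap.toSpanSingleton A _ (N.mkQ x)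
  have hx0 : N.mkQ x ≠ 0 := by simpa using hx
  have hT : Function.Surjective T := IsSimpleModule.toSpanSingleton_surjective A hx0
  let m' : Ideal A := LinearMap.ker T
  have hm' : m'.IsMaximal := IsSimpleModule.ker_toSpanSingleton_isMaximal A hx0
  have hIm : I ≤ m' := hIrad.trans (sInf_le ⟨bot_le, hm'⟩)
  have hmtop : m'.map π ≠ ⊤ := by
    intro h
    rw [Ideal.eq_top_iff_one, Ideal.mem_map_iff_of_surjective π hπ] at h
    obtain ⟨a, ha, ha1⟩ := h
    have h1 : a - 1 ∈ I := by rw [← hker, RingHom.mem_ker, map_sub, ha1, map_one, sub_self]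
    apply hm'.ne_top
    rw [Ideal.eq_top_iff_one]
    simpa using m'.sub_mem ha (hIm h1)
  obtain ⟨M, hM, hmM⟩ := Ideal.exists_le_maximal _ hmtop
  obtain ⟨y, hy, hMy⟩ := kasch hB M hM.ne_top (sInf_le hM.out)
  obtain ⟨z, rfl⟩ := hπ y
  let g : (A ⧸ m') →ₗ[A] (A ⧸ I) :=
    m'.liftQ (LinearMap.toSpanSingleton A (A ⧸ I) (Submodule.Quotient.mk z)) (by
      intro a ha
      rw [LinearMap.mem_ker, LinearMap.toSpanSingleton_apply, ← Submodule.Quotient.mk_smul,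
        Submodule.Quotient.mk_eq_zero, ← hker, RingHom.mem_ker, smul_eq_mul, map_mul]
      exact hMy _ (hmM (Ideal.mem_map_of_mem _ ha)))
  let e : (A ⧸ m') ≃ₗ[A] (I ⧸ N) := T.quotKerEquivOfSurjective hT
  refine ⟨g ∘ₗ e.symm.toLinearMap ∘ₗ N.mkQ, fun h0 => ?_⟩
  have h1 : e (Submodule.Quotient.mk 1) = N.mkQ x := by
    change (1 : A) • N.mkQ x = N.mkQ x
    rw [one_smul]
  have h2 : e.symm (N.mkQ x) = Submodule.Quotient.mk 1 := by
    rw [← h1, LinearEquiv.symm_apply_apply]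
  have h3 := LinearMap.congr_fun h0 x
  rw [LinearMap.comp_apply, LinearMap.comp_apply, LinearEquiv.coe_coe, h2] at h3
  have h4 : (1 : A) • (Submodule.Quotient.mk z : A ⧸ I) = 0 := h3
  rw [one_smul, Submodule.Quotient.mk_eq_zero, ← hker, RingHom.mem_ker] at h4
  exact hy h4

/-- If `Ext¹(A/I, Y)` vanishes then maps `I → Y` extend to `A`. -/
lemma ext_extend (k : Type u) [Field k] (A : Type u) [Ring A] [Algebra k A] (I : Ideal A)
    (Y : ModuleCat.{u} A)
    (h : Subsingleton (↥(((Ext k (ModuleCat.{u} A) 1).obj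
          (Opposite.op (ModuleCat.of A (A ⧸ I)))).obj Y)))
    (f : I →ₗ[A] Y) : ∃ g : A →ₗ[A] Y, ∀ x : I, g x = f x := by
  let X := ModuleCat.of A (A ⧸ I)
  let P : ProjectiveResolution X := ProjectiveResolution.of X
  have hz : Limits.IsZero ((P.complex.linearYonedaObj k Y).homology 1) :=
    (ModuleCat.isZero_of_subsingleton _).of_iso (P.isoExt (R := k) 1 Y).symm
  rw [← HomologicalComplex.exactAt_iff_isZero_homology,
    HomologicalComplex.exactAt_iff' _ 0 1 2 (by simp) (by simp),
    ShortComplex.moduleCat_exact_iff] at hz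
  have key : ∀ φ : P.complex.X 1 ⟶ Y, P.complex.d 2 1 ≫ φ = 0 →
      ∃ ψ : P.complex.X 0 ⟶ Y, P.complex.d 1 0 ≫ ψ = φ := fun φ hφ => hz φ hφ
  let ε : P.complex.X 0 ⟶ X := P.π.f 0
  have hε : Function.Surjective ε := (ModuleCat.epi_iff_surjective _).mp
    (inferInstanceAs (Epi (P.π.f 0)))
  have hex : ∀ p : P.complex.X 0, ε p = 0 → ∃ q : P.complex.X 1, P.complex.d 1 0 q = p :=
    (ShortComplex.moduleCat_exact_iff _).mp P.exact₀
  have hdε : ∀ q : P.complex.X 1, ε (P.complex.d 1 0 q) = 0 := fun q =>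
    ConcreteCategory.congr_hom P.complex_d_comp_π_f_zero q
  have : Module.Projective A (P.complex.X 0) :=
    (IsProjective.iff_projective _).mpr (P.projective 0)
  obtain ⟨α, hα⟩ := Module.projective_lifting_property I.mkQ ε.hom I.mkQ_surjective
  obtain ⟨γ, hγ⟩ := Module.projective_lifting_property ε.hom I.mkQ hε
  have hα' : ∀ p, I.mkQ (α p) = ε p := fun p => LinearMap.congr_fun hα p
  have hγ' : ∀ a, ε (γ a) = I.mkQ a := fun a => LinearMap.congr_fun hγ a
  let β : P.complex.X 1 →ₗ[A] I := (α ∘ₗ (P.complex.d 1 0).hom).codRestrict I (fun q => by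
    rw [← Submodule.Quotient.mk_eq_zero, ← Submodule.mkQ_apply]
    exact (hα' _).trans (hdε q))
  have hβ : ∀ q, (β q : A) = α (P.complex.d 1 0 q) := fun q => rfl
  obtain ⟨ψ, hψ⟩ := key (ModuleCat.ofHom (f ∘ₗ β)) (by
    ext q
    change f (β (P.complex.d 2 1 q)) = 0
    have h0 : β (P.complex.d 2 1 q) = 0 := by
      apply Subtype.ext
      rw [hβ]
      have : P.complex.d 1 0 (P.complex.d 2 1 q) = 0 :=
        ConcreteCategory.congr_hom (P.complex.d_comp_d 2 1 0) q
      rw [this, map_zero]; rfl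
    rw [h0, map_zero])
  have hψ' : ∀ q, ψ (P.complex.d 1 0 q) = f (β q) := fun q => ConcreteCategory.congr_hom hψ q
  let δ : A →ₗ[A] I := (α ∘ₗ γ - LinearMap.id).codRestrict I (fun a => by
    rw [← Submodule.Quotient.mk_eq_zero, ← Submodule.mkQ_apply, LinearMap.sub_apply, map_sub,
      sub_eq_zero]
    exact (hα' _).trans (hγ' a))
  have hδ : ∀ a, (δ a : A) = α (γ a) - a := fun a => rfl
  refine ⟨ψ.hom ∘ₗ γ - f ∘ₗ δ, fun x => ?_⟩
  obtain ⟨q, hq⟩ := hex (γ x) (by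
    rw [hγ', Submodule.mkQ_apply, Submodule.Quotient.mk_eq_zero]; exact x.2)
  have h1 : β q = x + δ x := by
    apply Subtype.ext
    rw [hβ, hq, Submodule.coe_add, hδ]; abel
  have h2 : ψ (γ x) = f x + f (δ x) := by rw [← hq, hψ', h1, map_add]
  change ψ (γ x) - f (δ x) = f x
  rw [h2]; abel

/-- Let `A` be a finite-dimensional selfinjective algebra over a field `k`,
and let `I` be a nonzero proper two-sided ideal of `A` contained in the Jacobson radical,
such that the quotient algebra `A/I` (encoded by a surjective ring homomorphism `π : A → B`
with kernel `I`) is selfinjective.  Then `Ext¹_A(A/I, A/I) ≠ 0`. -/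
theorem stmt14 (k : Type u) [Field k] (A : Type u) [Ring A] [Algebra k A]
    [FiniteDimensional k A] (hself : Module.Injective A A)
    (I : Ideal A) (hItwoSided : ∀ a ∈ I, ∀ b : A, a * b ∈ I)
    (hInezero : I ≠ ⊥) (hIproper : I ≠ ⊤)
    (hIrad : I ≤ (⊥ : Ideal A).jacobson)
    (B : Type u) [Ring B] (π : A →+* B) (hπ : Function.Surjective π)
    (hker : RingHom.ker π = I) (hB : Module.Injective B B) :
    Nontrivial
      (↥(((Ext k (ModuleCat.{u} A) 1).obj
          (Opposite.op (ModuleCat.of A (A ⧸ I)))).obj (ModuleCat.of A (A ⧸ I)))) := by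
  have : IsNoetherianRing A := isNoetherian_of_tower k inferInstance
  have : IsArtinianRing A := isArtinian_of_tower k inferInstance
  have : IsArtinianRing B := hπ.isArtinianRing
  let iB : Algebra k B := RingHom.toAlgebra' (π.comp (algebraMap k A)) (by
    intro c b
    obtain ⟨a, rfl⟩ := hπ b
    rw [RingHom.comp_apply, ← map_mul, ← map_mul, Algebra.commutes])
  let πk : A →ₐ[k] B := { π with commutes' := fun c => rfl }
  have : Module.Finite k B := Module.Finite.of_surjective πk.toLinearMap hπ
  have : IsNoetherian Bᵐᵒᵖ B := isNoetherian_of_tower k inferInstance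
  obtain ⟨f, hf⟩ := exists_hom I hInezero hIrad π hπ hker hB
  rw [← not_subsingleton_iff_nontrivial]
  intro hsub
  obtain ⟨g, hg⟩ := ext_extend k A I _ hsub f
  apply hf
  ext x
  obtain ⟨b, hb⟩ := Submodule.Quotient.mk_surjective I (g 1)
  have h1 : g x = (x : A) • g 1 := by rw [← map_smul, smul_eq_mul, mul_one]
  have h2 : (x : A) • g 1 = 0 := by
    rw [← hb]
    change (x : A) • (Submodule.Quotient.mk b : A ⧸ I) = 0
    rw [← Submodule.Quotient.mk_smul, Submodule.Quotient.mk_eq_zero]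
    exact hItwoSided _ x.2 b
  rw [← hg, h1, h2]
  rfl
end
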